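/- Let a ∈ (−2,0) with a ≠ −1 and b ∈ (0,2). Set ℓ = b/(a+2), m = −(b−1)/(a+1), n = (b−2)/(4a), and define H(x,y) = y^a·(x² + ℓy² + my + n) for y > 0. Then H is a first integral on the open upper half-plane of the quadratic system ẋ = (b−2)/4 + (1−b)y + ax² + by², ẏ = −2xy; that is, for all (x,y) with y > 0, ∂ₓH(x,y)·((b−2)/4 + (1−b)y + ax² + by²) + ∂_yH(x,y)·(−2xy) = 0. -/

import Mathlib

/-- for `a ∈ (−2,0)`, `a ≠ −1`, `b ∈ (0,2)`, the function
`H(x,y) = y^a·(x² + ℓy² + my + n)` with `ℓ = b/(a+2)`, `m = −(b−1)/(a+1)`,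
`n = (b−2)/(4a)` is a first integral on the open upper half-plane of the quadratic
system `ẋ = (b−2)/4 + (1−b)y + ax² + by²`, `ẏ = −2xy`. -/
theorem stmt_6 (a b : ℝ) (ha1 : -2 < a) (ha2 : a < 0) (ha3 : a ≠ -1)
    (hb1 : 0 < b) (hb2 : b < 2) :
    ∀ x y : ℝ, 0 < y →
      let l : ℝ := b / (a + 2)
      let m : ℝ := -(b - 1) / (a + 1)
      let n : ℝ := (b - 2) / (4 * a)
      let H : ℝ → ℝ → ℝ := fun x y => y ^ a * (x ^ 2 + l * y ^ 2 + m * y + n)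
      deriv (fun t => H t y) x * ((b - 2) / 4 + (1 - b) * y + a * x ^ 2 + b * y ^ 2) +
        deriv (fun t => H x t) y * (-2 * x * y) = 0 := by
  intro x y hy l m n H
  have hl : (a + 2) * l = b := mul_div_cancel₀ b (by linarith)
  have hm : (a + 1) * m = -(b - 1) :=
    mul_div_cancel₀ _ (fun h => ha3 (by linarith))
  have hn : 4 * a * n = b - 2 :=
    mul_div_cancel₀ _ (mul_ne_zero (by norm_num) ha2.ne)
  have h1 : HasDerivAt (fun t => H t y) (y ^ a * (2 * x)) x := by
    have h := ((((hasDerivAt_id x).pow 2).add_const (l * y ^ 2)).add_const (m * y)).add_const n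
    have h' := h.const_mul (y ^ a)
    refine HasDerivAt.congr_deriv (f := _) h' ?_
    simp
  have h2 : HasDerivAt (fun t => H x t)
      (a * y ^ (a - 1) * (x ^ 2 + l * y ^ 2 + m * y + n) + y ^ a * (l * (2 * y) + m)) y := by
    have h := (((((hasDerivAt_id y).pow 2).const_mul l).const_add (x ^ 2)).add
      ((hasDerivAt_id y).const_mul m)).add_const n
    have h' := (Real.hasDerivAt_rpow_const (p := a) (Or.inl hy.ne')).mul h
    refine HasDerivAt.congr_deriv (f := _) h' ?_
    simp
  have hp : y ^ (a - 1) * y = y ^ a := by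
    rw [Real.rpow_sub_one hy.ne', div_mul_cancel₀ _ hy.ne']
  rw [h1.deriv, h2.deriv]
  clear_value l m n
  linear_combination (-2 * x * a * (x ^ 2 + l * y ^ 2 + m * y + n)) * hp
    - 2 * x * y ^ a * (y ^ 2 * hl + y * hm + hn / 4)
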